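/- Let H be a B-hypergraph on vertex set V, S ⊆ V nonempty, and let P be a finite acyclic subhypergraph of H containing a vertex t such that every minimal vertex of P belongs to S. Let P' be the augmentation of P obtained by adding a new vertex o ∉ V together with a hyperedge ({o}, {s}) for every s ∈ S ∩ V(P). Then P' contains a B-hyperpath from o to t, i.e., a subhypergraph of P' admitting a linear ordering E₁, …, Eₙ of its hyperedges such that E_k⁻ ⊆ {o} ∪ ⋃_{j<k} E_j⁺ for all k and t ∈ Eₙ⁺. -/

import Mathlib

/-- A directed hypergraph on a vertex type `V`: a set of vertices together with a set of
hyperedges, each hyperedge being a pair `(E⁻, E⁺)` of finite sets of vertices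
(its tail and head), all of whose vertices belong to the vertex set. -/
structure DirectedHypergraph (V : Type*) where
  verts : Set V
  edges : Set (Finset V × Finset V)
  wf_tail : ∀ E ∈ edges, ∀ v ∈ E.1, v ∈ verts
  wf_head : ∀ E ∈ edges, ∀ v ∈ E.2, v ∈ verts

namespace DirectedHypergraph

variable {V : Type*}

/-- The one-step relation: `x` is in the tail and `y` in the head of a common hyperedge. -/
def OneStep (H : DirectedHypergraph V) (x y : V) : Prop :=
  ∃ E ∈ H.edges, x ∈ E.1 ∧ y ∈ E.2

/-- Reachability: the reflexive-transitive closure of the one-step relation. -/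
def Reach (H : DirectedHypergraph V) : V → V → Prop :=
  Relation.ReflTransGen H.OneStep

/-- Acyclicity: the transitive closure of the one-step relation is irreflexive. -/
def Acyclic (H : DirectedHypergraph V) : Prop :=
  ∀ x : V, ¬ Relation.TransGen H.OneStep x x

/-- A vertex `z` is minimal if `y ≤ z` implies `y = z`. -/
def MinimalVert (H : DirectedHypergraph V) (z : V) : Prop :=
  z ∈ H.verts ∧ ∀ y : V, H.Reach y z → y = z

/-- `H` is grounded if below every vertex there is a minimal vertex. -/
def Grounded (H : DirectedHypergraph V) : Prop :=
  ∀ x ∈ H.verts, ∃ z : V, H.MinimalVert z ∧ H.Reach z x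

/-- `H'` is a subhypergraph of `H`. -/
def Subhypergraph (H' H : DirectedHypergraph V) : Prop :=
  H'.verts ⊆ H.verts ∧ H'.edges ⊆ H.edges

/-- `H` is a B-hypergraph: every head is a singleton. -/
def IsB (H : DirectedHypergraph V) : Prop :=
  ∀ E ∈ H.edges, ∃ y : V, E.2 = {y}

end DirectedHypergraph

namespace DirectedHypergraph

variable {V : Type*}

/-- A list of hyperedges `E₁, …, Eₙ` is a B-hyperpath ordering from `s` to `t` if
`E_k⁻ ⊆ {s} ∪ ⋃_{j<k} E_j⁺` for all `k` and `t ∈ Eₙ⁺`. -/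
def IsBHyperpathOrder (s t : V) (L : List (Finset V × Finset V)) : Prop :=
  (∀ i : Fin L.length, ∀ z ∈ (L.get i).1,
      z = s ∨ ∃ j : Fin L.length, (j : ℕ) < (i : ℕ) ∧ z ∈ (L.get j).2) ∧
  ∃ E, L.getLast? = some E ∧ t ∈ E.2

/-- `Q` is a B-hyperpath from `s` to `t` in `H`: a subhypergraph of `H` whose hyperedges
admit a linear ordering that is a B-hyperpath ordering from `s` to `t`. -/
def IsBHyperpath (H : DirectedHypergraph V) (s t : V) (Q : DirectedHypergraph V) : Prop :=
  Q.Subhypergraph H ∧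
    ∃ L : List (Finset V × Finset V),
      L.Nodup ∧ {E | E ∈ L} = Q.edges ∧ IsBHyperpathOrder s t L

end DirectedHypergraph

namespace DirectedHypergraph

variable {V : Type*}

/-- Augmentation of `H` by a new vertex `o` and one hyperedge `({o}, {s})` for each `s ∈ S`. -/
def augment (H : DirectedHypergraph V) (S : Set V) (hS : S ⊆ H.verts) (o : V) :
    DirectedHypergraph V where
  verts := insert o H.verts
  edges := H.edges ∪ {E | ∃ s ∈ S, E = ({o}, ({s} : Finset V))}
  wf_tail := by
    rintro E (hE | ⟨s, hs, rfl⟩) v hv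
    · exact Set.mem_insert_of_mem _ (H.wf_tail E hE v hv)
    · simp only [Finset.mem_singleton] at hv
      subst hv; exact Set.mem_insert _ _
  wf_head := by
    rintro E (hE | ⟨s, hs, rfl⟩) v hv
    · exact Set.mem_insert_of_mem _ (H.wf_head E hE v hv)
    · simp only [Finset.mem_singleton] at hv
      subst hv; exact Set.mem_insert_of_mem _ (hS hs)

/-- The subhypergraph of `Q` consisting of its hyperedges that belong to `H`, together
with all vertices occurring in them. -/
def edgeRestrict (Q H : DirectedHypergraph V) : DirectedHypergraph V where
  verts := {v | ∃ E ∈ Q.edges ∩ H.edges, v ∈ E.1 ∨ v ∈ E.2}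
  edges := Q.edges ∩ H.edges
  wf_tail := fun E hE v hv => ⟨E, hE, Or.inl hv⟩
  wf_head := fun E hE v hv => ⟨E, hE, Or.inr hv⟩

end DirectedHypergraph

/-- Repetition-free lists of hyperedges, built by appending hyperedges with covered tail. -/
inductive GoodList {V : Type*} (A : Set (Finset V × Finset V)) (o : V) :
    List (Finset V × Finset V) → Prop
  | nil : GoodList A o []
  | snoc (L : List (Finset V × Finset V)) (E : Finset V × Finset V) :
      GoodList A o L → E ∈ A → E ∉ L →
      (∀ z ∈ E.1, z = o ∨ ∃ F ∈ L, z ∈ F.2) → GoodList A o (L ++ [E])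

theorem GoodList.nodup {V : Type*} {A : Set (Finset V × Finset V)} {o : V}
    {L : List (Finset V × Finset V)} (h : GoodList A o L) : L.Nodup := by
  induction h with
  | nil => simp
  | snoc L E _ _ hn _ ih =>
    rw [List.nodup_append]
    refine ⟨ih, by simp, ?_⟩
    intro a ha b hb hab
    simp only [List.mem_singleton] at hb
    subst hb; subst hab; exact hn ha

theorem GoodList.mem {V : Type*} {A : Set (Finset V × Finset V)} {o : V}
    {L : List (Finset V × Finset V)} (h : GoodList A o L) : ∀ E ∈ L, E ∈ A := by
  induction h with
  | nil => simp
  | snoc L E _ hE _ _ ih =>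
    intro F hF
    rcases List.mem_append.1 hF with hF | hF
    · exact ih F hF
    · rw [List.mem_singleton.1 hF]; exact hE

theorem GoodList.order {V : Type*} {A : Set (Finset V × Finset V)} {o : V}
    {L : List (Finset V × Finset V)} (h : GoodList A o L) :
    ∀ i : ℕ, ∀ hi : i < L.length, ∀ z ∈ (L[i]).1,
      z = o ∨ ∃ j : ℕ, ∃ hj : j < L.length, j < i ∧ z ∈ (L[j]).2 := by
  induction h with
  | nil => intro i hi; simp at hi
  | snoc L E _ _ _ hc ih =>
    intro i hi z hz
    by_cases hiL : i < L.length
    · rw [List.getElem_append_left hiL] at hz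
      rcases ih i hiL z hz with h | ⟨j, hj, hji, hzj⟩
      · exact Or.inl h
      · refine Or.inr ⟨j, by simp; omega, hji, ?_⟩
        rw [List.getElem_append_left hj]; exact hzj
    · have hi' : i = L.length := by simp at hi; omega
      subst hi'
      simp at hz
      rcases hc z hz with h | ⟨F, hF, hzF⟩
      · exact Or.inl h
      · obtain ⟨j, hj, rfl⟩ := List.mem_iff_getElem.1 hF
        refine Or.inr ⟨j, by simp; omega, hj, ?_⟩
        rw [List.getElem_append_left hj]; exact hzF

theorem GoodList.trim {V : Type*} {A : Set (Finset V × Finset V)} {o t : V}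
    {L : List (Finset V × Finset V)} (h : GoodList A o L) :
    (∃ F ∈ L, t ∈ F.2) → ∃ L', GoodList A o L' ∧ ∃ E, L'.getLast? = some E ∧ t ∈ E.2 := by
  induction h with
  | nil => simp
  | snoc L E hL hE hn hc ih =>
    rintro ⟨F, hF, htF⟩
    rcases List.mem_append.1 hF with hF | hF
    · exact ih ⟨F, hF, htF⟩
    · rw [List.mem_singleton.1 hF] at htF
      exact ⟨L ++ [E], .snoc L E hL hE hn hc, E, by simp, htF⟩

theorem GoodList.add {V : Type*} {A : Set (Finset V × Finset V)} {o : V}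
    {L : List (Finset V × Finset V)} (h : GoodList A o L) (E : Finset V × Finset V)
    (hE : E ∈ A) (hc : ∀ z ∈ E.1, z = o ∨ ∃ F ∈ L, z ∈ F.2) :
    ∃ L', GoodList A o L' ∧ L ⊆ L' ∧ E ∈ L' := by
  by_cases hn : E ∈ L
  · exact ⟨L, h, fun _ hx => hx, hn⟩
  · exact ⟨L ++ [E], .snoc L E h hE hn hc, by simp, by simp⟩

theorem GoodList.cover {V : Type*} {A : Set (Finset V × Finset V)} {o : V} (T : Finset V)
    (hT : ∀ z ∈ T, ∀ L, GoodList A o L →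
      ∃ L', GoodList A o L' ∧ L ⊆ L' ∧ ∃ F ∈ L', z ∈ F.2) :
    ∀ L, GoodList A o L →
      ∃ L', GoodList A o L' ∧ L ⊆ L' ∧ ∀ z ∈ T, ∃ F ∈ L', z ∈ F.2 := by
  classical
  induction T using Finset.induction_on with
  | empty => exact fun L hL => ⟨L, hL, fun _ hx => hx, by simp⟩
  | insert a T _ ih =>
    intro L hL
    obtain ⟨L1, h1, hs1, hc1⟩ := ih (fun z hz => hT z (Finset.mem_insert_of_mem hz)) L hL
    obtain ⟨L2, h2, hs2, F, hF, haF⟩ := hT a (Finset.mem_insert_self _ _) L1 h1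
    refine ⟨L2, h2, fun _ hx => hs2 (hs1 hx), ?_⟩
    intro z hz
    rcases Finset.mem_insert.1 hz with rfl | hz
    · exact ⟨F, hF, haF⟩
    · obtain ⟨G, hG, hzG⟩ := hc1 z hz
      exact ⟨G, hs2 hG, hzG⟩

open DirectedHypergraph in
/-- Let `P` be a finite acyclic subhypergraph of a B-hypergraph `H`
containing `t` such that every minimal vertex of `P` belongs to `S`. Then the augmentation
`P'` of `P` (by a new vertex `o` and edges `({o},{s})` for `s ∈ S ∩ V(P)`) contains a
B-hyperpath from `o` to `t`. -/
theorem acyclic_subhypergraph_contains_bhyperpath {V : Type*}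
    (H : DirectedHypergraph V) (hB : H.IsB)
    (S : Set V) (hSne : S.Nonempty) (hSV : S ⊆ H.verts)
    (P : DirectedHypergraph V) (hPH : P.Subhypergraph H)
    (hfinV : P.verts.Finite) (hfinE : P.edges.Finite) (hacyc : P.Acyclic)
    (t : V) (ht : t ∈ P.verts)
    (hmin : ∀ z : V, P.MinimalVert z → z ∈ S)
    (o : V) (ho : o ∉ H.verts) :
    ∃ Qpath : DirectedHypergraph V,
      (P.augment (S ∩ P.verts) Set.inter_subset_right o).IsBHyperpath o t Qpath := by
  classical
  set A := (P.augment (S ∩ P.verts) Set.inter_subset_right o).edges with hA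
  have key : ∀ v ∈ P.verts, ∀ L, GoodList A o L →
      ∃ L', GoodList A o L' ∧ L ⊆ L' ∧ ∃ F ∈ L', v ∈ F.2 := by
    haveI : IsStrictOrder V (Relation.TransGen P.OneStep) :=
      { irrefl := hacyc
        trans := fun _ _ _ h1 h2 => h1.trans h2 }
    have wf : P.verts.WellFoundedOn (Relation.TransGen P.OneStep) := hfinV.wellFoundedOn
    intro v hv
    refine wf.induction (P := fun v => ∀ L, GoodList A o L →
      ∃ L', GoodList A o L' ∧ L ⊆ L' ∧ ∃ F ∈ L', v ∈ F.2) hv ?_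
    intro v hv ih L hL
    by_cases hm : P.MinimalVert v
    · obtain ⟨L', h1, h2, h3⟩ := hL.add ({o}, {v})
        (Or.inr ⟨v, ⟨hmin v hm, hv⟩, rfl⟩) (by simp)
      exact ⟨L', h1, h2, _, h3, by simp⟩
    · have : ∃ y, P.Reach y v ∧ y ≠ v := by
        by_contra hcon
        push Not at hcon
        exact hm ⟨hv, hcon⟩
      obtain ⟨y, hy, hne⟩ := this
      rcases Relation.ReflTransGen.cases_tail hy with h | ⟨x, _, E, hE, hx, hvE⟩
      · exact absurd h.symm hne
      · obtain ⟨L1, h1, hs1, hc1⟩ := GoodList.cover (A := A) (o := o) E.1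
          (fun z hz => ih z (P.wf_tail E hE z hz) (.single ⟨E, hE, hz, hvE⟩)) L hL
        obtain ⟨L2, h2, hs2, hE2⟩ := h1.add E (Or.inl hE) (fun z hz => Or.inr (hc1 z hz))
        exact ⟨L2, h2, fun _ hx => hs2 (hs1 hx), E, hE2, hvE⟩
  obtain ⟨L0, h0, _, hc0⟩ := key t ht [] .nil
  obtain ⟨L, hL, hlast⟩ := h0.trim hc0
  refine ⟨⟨(P.augment (S ∩ P.verts) Set.inter_subset_right o).verts, {E | E ∈ L},
    fun E hE => DirectedHypergraph.wf_tail _ E (hL.mem E hE),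
    fun E hE => DirectedHypergraph.wf_head _ E (hL.mem E hE)⟩,
    ⟨fun _ hx => hx, fun E hE => hL.mem E hE⟩, L, hL.nodup, rfl, ?_, hlast⟩
  intro i z hz
  rcases hL.order i i.2 z hz with h | ⟨j, hj, hji, hzj⟩
  · exact Or.inl h
  · exact Or.inr ⟨⟨j, hj⟩, hji, hzj⟩
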